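/- arXiv:math/0409347 — 2 statements merged into one kernel-verified Lean document; each statement's English description precedes it below -/
import Mathlib

section
/- Let A and X be n×n real matrices with X symmetric (X = Xᵀ) and satisfying the algebraic Riccati equation X·X + X·A + Aᵀ·X = 0. Suppose that every complex root z of the characteristic polynomial of −A − X (regarded as a complex matrix) satisfies Re(z) ≤ 0. Then trace(−A − X) = −∑_σ |Re(σ)|, where the sum runs over all complex roots σ of the characteristic polynomial of A, counted with multiplicity. -/
open Matrix

theorem Matrix.charpoly_neg_eq_comp {m R : Type*} [Fintype m] [DecidableEq m] [CommRing R]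
    (M : Matrix m m R) :
    (-M).charpoly = (-1) ^ Fintype.card m * M.charpoly.comp (-Polynomial.X) := by
  have h : M.charpoly.comp (-Polynomial.X) =
      ((Polynomial.compRingHom (-Polynomial.X)).mapMatrix M.charmatrix).det := by
    rw [← RingHom.map_det]; rfl
  rw [h, ← Matrix.det_neg, Matrix.charpoly]
  congr 1
  ext1 i j
  by_cases hij : i = j
  · subst hij
    simp [charmatrix_apply_eq, add_comm]
  · simp [charmatrix_apply_ne _ _ _ hij]

/-- The roots of the characteristic polynomial of `-M` are the negatives of those of `M`. -/
theorem Matrix.roots_charpoly_neg {m R : Type*} [Fintype m] [DecidableEq m] [CommRing R]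
    [IsDomain R] (M : Matrix m m R) :
    (-M).charpoly.roots = M.charpoly.roots.map fun x ↦ -x := by
  rw [charpoly_neg_eq_comp, ← Polynomial.roots_comp_neg_X]
  rcases neg_one_pow_eq_or (Polynomial R) (Fintype.card m) with h | h <;> simp [h]

/-- A solution `X` of the Riccati equation `X * X + X * A + C * X = 0` block-triangularizes the
associated Hamiltonian matrix. -/
theorem Matrix.charpoly_mul_charpoly_of_riccati {m R : Type*} [Fintype m] [DecidableEq m]
    [CommRing R] {A C X : Matrix m m R} (h : X * X + X * A + C * X = 0) :
    (-A).charpoly * C.charpoly = (-A - X).charpoly * (C + X).charpoly := by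
  have hC : C * X = X * (-A - X) := by
    rw [← sub_eq_zero, ← h]; noncomm_ring
  have hH : fromBlocks (-A) (-1) 0 C =
      fromBlocks 1 0 X 1 * (fromBlocks (-A - X) (-1) 0 (C + X) * fromBlocks 1 0 (-X) 1) := by
    simp only [fromBlocks_multiply, fromBlocks_inj]
    refine ⟨?_, ?_, ?_, ?_⟩
    · noncomm_ring
    · noncomm_ring
    · trans X * (-A - X) - C * X
      · rw [hC, sub_self]
      · noncomm_ring
    · noncomm_ring
  have hQP : fromBlocks 1 0 (-X) 1 * fromBlocks 1 0 X 1 = (1 : Matrix (m ⊕ m) (m ⊕ m) R) := by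
    simp [fromBlocks_multiply]
  rw [← charpoly_fromBlocks_zero₂₁ (-A) (-1) C, hH, charpoly_mul_comm, mul_assoc, hQP, mul_one,
    charpoly_fromBlocks_zero₂₁]

/-- If real matrices `A, X` with `X` symmetric satisfy the algebraic Riccati
equation `X·X + X·A + Aᵀ·X = 0`, and every complex root `z` of the characteristic
polynomial of `-A - X` has `Re z ≤ 0`, then
`trace (-A - X) = -∑_σ |Re σ|`, the sum over all complex roots `σ` of the characteristic
polynomial of `A`, with multiplicity. -/
theorem stmt_4 {n : ℕ} (A X : Matrix (Fin n) (Fin n) ℝ)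
    (hsym : X = Xᵀ)
    (hric : X * X + X * A + Aᵀ * X = 0)
    (hre : ∀ z ∈ (((-A - X).charpoly).map (algebraMap ℝ ℂ)).roots, z.re ≤ 0) :
    Matrix.trace (-A - X) =
      -((((A.charpoly).map (algebraMap ℝ ℂ)).roots).map (fun σ => |σ.re|)).sum := by
  have key := charpoly_mul_charpoly_of_riccati hric
  have hT : Aᵀ + X = (-(-A - X))ᵀ := by
    simp [← hsym, add_comm]
  rw [hT, charpoly_transpose, charpoly_transpose] at key
  generalize -A - X = B at hre key ⊢
  have sum_neg (M : Matrix (Fin n) (Fin n) ℝ) :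
      (((-M).charpoly.map (algebraMap ℝ ℂ)).roots.map fun σ => |σ.re|).sum =
        ((M.charpoly.map (algebraMap ℝ ℂ)).roots.map fun σ => |σ.re|).sum := by
    have h : (-M).map (algebraMap ℝ ℂ) = -M.map (algebraMap ℝ ℂ) := by ext; simp
    rw [← charpoly_map, ← charpoly_map, h, roots_charpoly_neg, Multiset.map_map]
    simp
  have ne_zero (M : Matrix (Fin n) (Fin n) ℝ) : M.charpoly.map (algebraMap ℝ ℂ) ≠ 0 :=
    (M.charpoly_monic.map _).ne_zero
  have hroots := congrArg (fun p : Polynomial ℝ =>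
    ((p.map (algebraMap ℝ ℂ)).roots.map fun σ => |σ.re|).sum) key
  simp only [Polynomial.map_mul] at hroots
  rw [Polynomial.roots_mul (mul_ne_zero (ne_zero _) (ne_zero _)),
    Polynomial.roots_mul (mul_ne_zero (ne_zero _) (ne_zero _)), Multiset.map_add,
    Multiset.map_add, Multiset.sum_add, Multiset.sum_add, sum_neg, sum_neg] at hroots
  have htrace : B.trace = ((B.charpoly.map (algebraMap ℝ ℂ)).roots.map Complex.re).sum := by
    have h := trace_eq_sum_roots_charpoly (B.map (algebraMap ℝ ℂ))
    rw [charpoly_map] at h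
    have h2 : (B.map (algebraMap ℝ ℂ)).trace = (B.trace : ℂ) := by simp [trace]
    rw [h2] at h
    calc B.trace = Complex.reAddGroupHom (B.trace : ℂ) := by simp
      _ = _ := by rw [h, map_multiset_sum]; rfl
  have hB : ((B.charpoly.map (algebraMap ℝ ℂ)).roots.map fun σ => |σ.re|).sum = -B.trace := by
    rw [htrace, ← Multiset.sum_map_neg', Multiset.map_map]
    exact congrArg _ (Multiset.map_congr rfl fun z hz => abs_of_nonpos (hre z hz))
  linarith
end

section
/- Let ρ, θ ∈ ℝ. Suppose (f₁, g₁) : ℝ → ℝ² is differentiable and satisfies f₁'(t) = ρ·tanh(t)·f₁(t) and g₁'(t) = (1−ρ)·tanh(t)·g₁(t) for all t, and (f₂, g₂) : ℝ → ℝ² is differentiable and satisfies f₂'(t) = ρ·tanh(t)·f₂(t) − (θ/cosh t)·g₂(t) and g₂'(t) = (θ/cosh t)·f₂(t) + (1−ρ)·tanh(t)·g₂(t) for all t. Then f = f₁ + f₂ and g = g₁ + g₂ are twice differentiable and satisfy the second-order system: f''(t) + (θ/cosh t)·g'(t) − ((ρ + ρ²·sinh²t)/cosh²t)·f(t) + ((θρ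 − θ)·sinh(t)/cosh²t)·g(t) = 0 and g''(t) − (θ/cosh t)·f'(t) − (((1−ρ) + (1−ρ)²·sinh²t)/cosh²t)·g(t) + (θρ·sinh(t)/cosh²t)·f(t) = 0, for all t ∈ ℝ. -/
theorem hasDerivAt_tanh_one_div_cosh_sq (t : ℝ) :
    HasDerivAt Real.tanh (1 / Real.cosh t ^ 2) t := by
  have h := (Real.hasDerivAt_sinh t).div (Real.hasDerivAt_cosh t) (Real.cosh_pos t).ne'
  refine (h.congr_of_eventuallyEq (.of_forall Real.tanh_eq_sinh_div_cosh)).congr_deriv ?_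
  congr 1
  linarith [Real.cosh_sq t]

theorem hasDerivAt_const_div_cosh (c t : ℝ) :
    HasDerivAt (fun s => c / Real.cosh s) (-(c * Real.sinh t) / Real.cosh t ^ 2) t := by
  refine ((hasDerivAt_const t c).div (Real.hasDerivAt_cosh t)
    (Real.cosh_pos t).ne').congr_deriv ?_
  ring

/-- If `(f₁, g₁)` solves the first-order system `y' = A(t)y` with
`A(t) = tanh t · diag(ρ, 1-ρ)`, and `(f₂, g₂)` solves `y' = B(t)y` with
`B(t) = A(t) + (1/cosh t)·[[0,-θ],[θ,0]]`, then `f = f₁ + f₂`, `g = g₁ + g₂` are twice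
differentiable and solve the second-order (Jacobi) system
`f'' + (θ/cosh t)·g' - ((ρ + ρ²sinh²t)/cosh²t)·f + ((θρ-θ)sinh t/cosh²t)·g = 0`,
`g'' - (θ/cosh t)·f' - ((1-ρ + (1-ρ)²sinh²t)/cosh²t)·g + (θρ·sinh t/cosh²t)·f = 0`. -/
theorem stmt_14 (ρ θ : ℝ) (f₁ g₁ f₂ g₂ : ℝ → ℝ)
    (hf₁ : ∀ t : ℝ, HasDerivAt f₁ (ρ * Real.tanh t * f₁ t) t)
    (hg₁ : ∀ t : ℝ, HasDerivAt g₁ ((1 - ρ) * Real.tanh t * g₁ t) t)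
    (hf₂ : ∀ t : ℝ, HasDerivAt f₂ (ρ * Real.tanh t * f₂ t - (θ / Real.cosh t) * g₂ t) t)
    (hg₂ : ∀ t : ℝ, HasDerivAt g₂
      ((θ / Real.cosh t) * f₂ t + (1 - ρ) * Real.tanh t * g₂ t) t)
    (f g : ℝ → ℝ)
    (hf : ∀ t : ℝ, f t = f₁ t + f₂ t) (hg : ∀ t : ℝ, g t = g₁ t + g₂ t) :
    ∃ f' g' f'' g'' : ℝ → ℝ,
      (∀ t : ℝ, HasDerivAt f (f' t) t) ∧ (∀ t : ℝ, HasDerivAt g (g' t) t) ∧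
      (∀ t : ℝ, HasDerivAt f' (f'' t) t) ∧ (∀ t : ℝ, HasDerivAt g' (g'' t) t) ∧
      (∀ t : ℝ,
        f'' t + (θ / Real.cosh t) * g' t
          - ((ρ + ρ ^ 2 * Real.sinh t ^ 2) / Real.cosh t ^ 2) * f t
          + ((θ * ρ - θ) * Real.sinh t / Real.cosh t ^ 2) * g t = 0) ∧
      (∀ t : ℝ,
        g'' t - (θ / Real.cosh t) * f' t
          - (((1 - ρ) + (1 - ρ) ^ 2 * Real.sinh t ^ 2) / Real.cosh t ^ 2) * g t
          + (θ * ρ * Real.sinh t / Real.cosh t ^ 2) * f t = 0) := by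
  obtain rfl : f = f₁ + f₂ := funext hf
  obtain rfl : g = g₁ + g₂ := funext hg
  have hT := hasDerivAt_tanh_one_div_cosh_sq
  have hC := hasDerivAt_const_div_cosh θ
  refine ⟨_, _, _, _, fun t => (hf₁ t).add (hf₂ t), fun t => (hg₁ t).add (hg₂ t),
    fun t => (((hT t).const_mul ρ).mul (hf₁ t)).add
      ((((hT t).const_mul ρ).mul (hf₂ t)).sub ((hC t).mul (hg₂ t))),
    fun t => (((hT t).const_mul (1 - ρ)).mul (hg₁ t)).add
      (((hC t).mul (hf₂ t)).add (((hT t).const_mul (1 - ρ)).mul (hg₂ t))),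
    fun t => ?_, fun t => ?_⟩ <;>
  · have hc : Real.cosh t ≠ 0 := (Real.cosh_pos t).ne'
    simp only [Pi.add_apply, Real.tanh_eq_sinh_div_cosh]
    field_simp
    ring
end
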